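/- (Generalized Lawrence–Varchenko Formula) Let P ⊂ ℝ^d be a simple full-dimensional polytope with rational vertices, and for each vertex v of P choose a vector ξ_v ∈ ℝ^d with ξ_v·w ≠ 0 for every edge direction w of P at v. With E^±_v(ξ_v) and K_{ξ_v,v} defined as for the Lawrence–Varchenko formula, one has in ℂ(x_1,…,x_d): σ_P(x) = Σ_{v vertex of P} (−1)^{|E^−_v(ξ_v)|} φ(S_{K_{ξ_v,v}}), where σ_P(x) = Σ_{m ∈ P∩ℤ^d} x^m. -/

import Mathlib

open scoped BigOperators Classical

noncomputable section

/-- The real vector corresponding to an integer vector. -/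
def toR (d : ℕ) (m : Fin d → ℤ) : Fin d → ℝ := fun i => (m i : ℝ)

/-- The standard dot product on `ℝ^d`. -/
def dotR (d : ℕ) (x y : Fin d → ℝ) : ℝ := ∑ i, x i * y i

/-- Laurent polynomials `ℂ[x₁^{±1},…,x_d^{±1}]`, represented by their coefficient functions. -/
abbrev LaurentPoly (d : ℕ) := (Fin d → ℤ) →₀ ℂ

/-- The integer-point generating series of a subset of `ℝ^d`: the function `ℤ^d → ℂ`
equal to `1` on `S ∩ ℤ^d` and `0` elsewhere. -/
def genSeries (d : ℕ) (S : Set (Fin d → ℝ)) : (Fin d → ℤ) → ℂ :=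
  fun m => if toR d m ∈ S then 1 else 0

/-- The action of a Laurent polynomial on a formal Laurent series,
`(x^w · S)(m) = S(m - w)` extended linearly. -/
def actLP (d : ℕ) (g : LaurentPoly d) (S : (Fin d → ℤ) → ℂ) : (Fin d → ℤ) → ℂ :=
  fun m => ∑ w ∈ g.support, g w * S (m - w)

/-- The series of a Laurent polynomial `f`, i.e. `Σ_m f_m x^m` as a formal series. -/
def seriesOf (d : ℕ) (f : LaurentPoly d) : (Fin d → ℤ) → ℂ := fun m => f m

/-- The cone `v + ℝ_{≥0} w₁ + ⋯ + ℝ_{≥0} w_n`. -/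
def coneSet (d n : ℕ) (v : Fin d → ℝ) (w : Fin n → Fin d → ℤ) : Set (Fin d → ℝ) :=
  {y | ∃ lam : Fin n → ℝ, (∀ i, 0 ≤ lam i) ∧ y = v + ∑ i, lam i • toR d (w i)}

/-- The fundamental half-open parallelepiped `{v + Σ λᵢ wᵢ : 0 ≤ λᵢ < 1}`. -/
def parSet (d : ℕ) (v : Fin d → ℝ) (w : Fin d → Fin d → ℤ) : Set (Fin d → ℝ) :=
  {y | ∃ lam : Fin d → ℝ, (∀ i, 0 ≤ lam i ∧ lam i < 1) ∧ y = v + ∑ i, lam i • toR d (w i)}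

/-- A simple rational cone: `v + ℝ_{≥0} w₁ + ⋯ + ℝ_{≥0} w_d` with `w₁,…,w_d ∈ ℤ^d`
linearly independent. -/
def IsSimpleCone (d : ℕ) (K : Set (Fin d → ℝ)) : Prop :=
  ∃ (v : Fin d → ℝ) (w : Fin d → Fin d → ℤ),
    LinearIndependent ℝ (fun i => toR d (w i)) ∧ K = coneSet d d v w

/-- Membership in the module `PL` of polyhedral Laurent series: a finite
`ℂ[x₁^{±1},…,x_d^{±1}]`-linear combination of the series of simple rational cones. -/
def MemPL (d : ℕ) (S : (Fin d → ℤ) → ℂ) : Prop :=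
  ∃ (n : ℕ) (g : Fin n → LaurentPoly d) (K : Fin n → Set (Fin d → ℝ)),
    (∀ i, IsSimpleCone d (K i)) ∧ S = ∑ i, actLP d (g i) (genSeries d (K i))

/-- The field of rational functions `ℂ(x₁,…,x_d)`. -/
abbrev RatF (d : ℕ) := FractionRing (MvPolynomial (Fin d) ℂ)

/-- The monomial `x^w`, `w ∈ ℤ^d`, as a rational function. -/
def ratMon (d : ℕ) (w : Fin d → ℤ) : RatF d :=
  ∏ i, (algebraMap (MvPolynomial (Fin d) ℂ) (RatF d) (MvPolynomial.X i)) ^ (w i)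

/-- A Laurent polynomial as a rational function. -/
def toRat (d : ℕ) (g : LaurentPoly d) : RatF d :=
  ∑ w ∈ g.support, algebraMap (MvPolynomial (Fin d) ℂ) (RatF d) (MvPolynomial.C (g w)) * ratMon d w

/-- `σ_S(x) = Σ_{m ∈ S ∩ ℤ^d} x^m`, as a rational function (for `S` with finitely many
integer points). -/
def sigmaSet (d : ℕ) (S : Set (Fin d → ℝ)) : RatF d :=
  ∑ᶠ m ∈ {m : Fin d → ℤ | toR d m ∈ S}, ratMon d m

/-- `φ : PL → ℂ(x₁,…,x_d)` is the `ℂ[x₁^{±1},…,x_d^{±1}]`-module homomorphism sending the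
series `S_K` of a simple rational cone `K` to `σ_{P_K}(x) / Π (1 - x^{wᵢ})`. -/
def IsPhi (d : ℕ) (φ : ((Fin d → ℤ) → ℂ) → RatF d) : Prop :=
  (∀ S T, MemPL d S → MemPL d T → φ (S + T) = φ S + φ T) ∧
  (∀ (g : LaurentPoly d) (S), MemPL d S → φ (actLP d g S) = toRat d g * φ S) ∧
  (∀ (v : Fin d → ℝ) (w : Fin d → Fin d → ℤ),
      LinearIndependent ℝ (fun i => toR d (w i)) →
      φ (genSeries d (coneSet d d v w)) =
        sigmaSet d (parSet d v w) / ∏ i, (1 - ratMon d (w i)))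

/-- A convex polyhedron: an intersection of finitely many closed halfspaces. -/
def IsPolyhedron (d : ℕ) (P : Set (Fin d → ℝ)) : Prop :=
  ∃ (n : ℕ) (a : Fin n → Fin d → ℝ) (b : Fin n → ℝ),
    P = {y | ∀ i, dotR d (a i) y ≤ b i}

/-- The polar `P^∨ = {x : ⟨x,y⟩ ≤ 1 for all y ∈ P}`. -/
def polar (d : ℕ) (P : Set (Fin d → ℝ)) : Set (Fin d → ℝ) :=
  {x | ∀ y ∈ P, dotR d x y ≤ 1}


/-- The half-open cone `K_{ξ,v} = v + Σ_{w·ξ>0} ℝ_{≥0} w + Σ_{w·ξ<0} ℝ_{<0} w`. -/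
def lvCone (d : ℕ) (v : Fin d → ℝ) (w : Fin d → Fin d → ℤ) (xi : Fin d → ℝ) :
    Set (Fin d → ℝ) :=
  {y | ∃ lam : Fin d → ℝ,
    (∀ i, (0 < dotR d xi (toR d (w i)) → 0 ≤ lam i) ∧
          (dotR d xi (toR d (w i)) < 0 → lam i < 0)) ∧
    y = v + ∑ i, lam i • toR d (w i)}

section Geometry

open Module

variable {E ι κ : Type*} [NormedAddCommGroup E] [NormedSpace ℝ E]

/-- `conv (range v)` is a simple polytope whose vertices are exactly the points `v k`, and `b k` is
a basis of edge directions at the vertex `v k`. -/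
structure IsSimplePolytope (v : ι → E) (b : ι → Basis κ ℝ E) : Prop where
  injective : Function.Injective v
  range_eq : Set.range v = Set.extremePoints ℝ (convexHull ℝ (Set.range v))
  cone : ∀ k y, (∃ t : ℝ, 0 < t ∧ v k + t • (y - v k) ∈ convexHull ℝ (Set.range v)) ↔
    ∀ i, 0 ≤ (b k).repr (y - v k) i

/-- The edge leaving the vertex `v p.1` in direction `b p.1 p.2` is the same as the edge leaving
`v q.1` in direction `b q.1 q.2`, traversed backwards. -/
def IsEdge (v : ι → E) (b : ι → Basis κ ℝ E) (p q : ι × κ) : Prop :=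
  ∃ T > (0 : ℝ), ∃ c > (0 : ℝ), v q.1 = v p.1 + T • b p.1 p.2 ∧ b q.1 q.2 = -(c • b p.1 p.2)

lemma IsEdge.symm {v : ι → E} {b : ι → Basis κ ℝ E} {p q : ι × κ} (h : IsEdge v b p q) :
    IsEdge v b q p := by
  obtain ⟨T, hT, c, hc, h1, h2⟩ := h
  refine ⟨T / c, div_pos hT hc, c⁻¹, inv_pos.2 hc, ?_, ?_⟩
  · rw [h1, h2, smul_neg, smul_smul, div_mul_cancel₀ _ hc.ne']
    abel
  · rw [h2, smul_neg, smul_smul, inv_mul_cancel₀ hc.ne', one_smul, neg_neg]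

lemma Module.Basis.repr_smul_self_of_ne (b : Basis κ ℝ E) (c : ℝ) {i j : κ} (h : j ≠ i) :
    b.repr (c • b i) j = 0 := by
  simp [h.symm]

lemma Module.Basis.repr_eq_sum_repr [Fintype κ] (b b' : Basis κ ℝ E) (y : E) (j : κ) :
    b'.repr y j = ∑ l, b.repr y l * b'.repr (b l) j := by
  conv_lhs => rw [← b.sum_repr y]
  rw [map_sum, Finsupp.finsetSum_apply]
  simp only [map_smul, Finsupp.smul_apply, smul_eq_mul]

/-- The sign of `x`, with `0` counted as positive. -/
def nnSign (x : ℝ) : ℝ := if 0 ≤ x then 1 else -1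

/-- If `ξ (b i) > 0`, this is the indicator of `b.repr y i ≥ 0`; if `ξ (b i) < 0`, it is minus the
indicator of `b.repr y i < 0`; if `ξ (b i) = 0`, it is the average of these two. -/
def signFactor (b : Basis κ ℝ E) (ξ : StrongDual ℝ E) (y : E) (i : κ) : ℝ :=
  (nnSign (b.repr y i) + Real.sign (ξ (b i))) / 2

/-- The signed sum of the indicators of the half-open vertex cones, evaluated at `y`. -/
def lvSum [Fintype ι] [Fintype κ] (v : ι → E) (b : ι → Basis κ ℝ E) (ξ : StrongDual ℝ E)
    (y : E) : ℝ :=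
  ∑ k, ∏ i, signFactor (b k) ξ (y - v k) i

namespace IsSimplePolytope

variable {v : ι → E} {b : ι → Basis κ ℝ E} (h : IsSimplePolytope v b)
include h

lemma repr_nonneg (k : ι) {y : E} (hy : y ∈ convexHull ℝ (Set.range v)) (i : κ) :
    0 ≤ (b k).repr (y - v k) i :=
  (h.cone k y).1 ⟨1, one_pos, by simpa using hy⟩ i

omit h in
lemma vertex_mem (v : ι → E) (k : ι) : v k ∈ convexHull ℝ (Set.range v) :=
  subset_convexHull ℝ _ ⟨k, rfl⟩

lemma exists_add_smul_mem (k : ι) (i : κ) :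
    ∃ t : ℝ, 0 < t ∧ v k + t • b k i ∈ convexHull ℝ (Set.range v) := by
  have := (h.cone k (v k + b k i)).2 fun j => by
    simp only [add_sub_cancel_left, Basis.repr_self, Finsupp.single_apply]
    split_ifs <;> norm_num
  simpa using this

lemma repr_nonneg_of_eq_add {p : ι × κ} {k : ι} {T : ℝ} (hk : v k = v p.1 + T • b p.1 p.2)
    {j : κ} (hj : j ≠ p.2) (m : κ) : 0 ≤ (b p.1).repr (b k m) j := by
  obtain ⟨t, ht, hm⟩ := h.exists_add_smul_mem k m
  have := h.repr_nonneg p.1 hm j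
  rw [hk, show v p.1 + T • b p.1 p.2 + t • b k m - v p.1 = T • b p.1 p.2 + t • b k m by abel,
    map_add, Finsupp.add_apply, Basis.repr_smul_self_of_ne _ _ hj, zero_add, map_smul,
    Finsupp.smul_apply, smul_eq_mul] at this
  exact nonneg_of_mul_nonneg_right this ht

lemma exists_vertex_eq_add [Finite ι] [FiniteDimensional ℝ E] (p : ι × κ) :
    ∃ k, ∃ T > (0 : ℝ), v k = v p.1 + T • b p.1 p.2 := by
  set P := convexHull ℝ (Set.range v) with hP
  set coord : κ → E → ℝ := fun j y => (b p.1).repr (y - v p.1) j with hcoord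
  have hcont : ∀ j, Continuous (coord j) := fun j =>
    (LinearMap.continuous_of_finiteDimensional ((b p.1).coord j)).comp
      (continuous_id.sub continuous_const)
  have hPc : IsCompact P := (Set.finite_range v).isCompact_convexHull (𝕜 := ℝ)
  have hF : IsCompact (P ∩ {y | ∀ j, j ≠ p.2 → coord j y = 0}) := by
    refine hPc.inter_right ?_
    simp only [Set.ofPred_forall]
    exact isClosed_iInter fun j => isClosed_iInter fun _ => isClosed_eq (hcont j) continuous_const
  have hcoord_add : ∀ (t : ℝ) (j : κ), coord j (v p.1 + t • b p.1 p.2) =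
      if j = p.2 then t else 0 := by
    intro t j
    simp [hcoord, Finsupp.single_apply, eq_comm]
  obtain ⟨t, ht, htP⟩ := h.exists_add_smul_mem p.1 p.2
  have htF : v p.1 + t • b p.1 p.2 ∈ P ∩ {y | ∀ j, j ≠ p.2 → coord j y = 0} :=
    ⟨htP, fun j hj => by rw [hcoord_add, if_neg hj]⟩
  obtain ⟨y, ⟨hyP, hy0⟩, hymax⟩ := hF.exists_isMaxOn ⟨_, htF⟩ (hcont p.2).continuousOn
  have hext : ∀ {x z : E}, (∀ j, coord j x = coord j z) → x = z := by
    intro x z hxz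
    have : x - v p.1 = z - v p.1 := (b p.1).repr.injective (Finsupp.ext hxz)
    simpa using this
  have hT : t ≤ coord p.2 y := by
    have := hymax htF
    simpa [hcoord_add] using this
  have hyeq : y = v p.1 + coord p.2 y • b p.1 p.2 := hext fun j => by
    rw [hcoord_add]
    split_ifs with hj
    · rw [hj]
    · exact hy0 j hj
  have hyext : y ∈ Set.extremePoints ℝ P := by
    rw [mem_extremePoints_iff_left]
    refine ⟨hyP, fun x₁ hx₁ x₂ hx₂ hy => ?_⟩
    obtain ⟨α, β, hα, hβ, hαβ, hy⟩ := hy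
    have hcomb : ∀ j, coord j y = α * coord j x₁ + β * coord j x₂ := by
      intro j
      have : y - v p.1 = α • (x₁ - v p.1) + β • (x₂ - v p.1) := by
        rw [← hy, smul_sub, smul_sub, sub_add_sub_comm, ← add_smul, hαβ, one_smul]
      simp only [hcoord, this]
      simp
    have hz : ∀ j, j ≠ p.2 → coord j x₁ = 0 ∧ coord j x₂ = 0 := by
      intro j hj
      have h0 := hcomb j
      rw [hy0 j hj] at h0
      have h1 : 0 ≤ coord j x₁ := h.repr_nonneg p.1 hx₁ j
      have h2 : 0 ≤ coord j x₂ := h.repr_nonneg p.1 hx₂ j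
      constructor <;> nlinarith [mul_nonneg hα.le h1, mul_nonneg hβ.le h2]
    have h1 : coord p.2 x₁ ≤ coord p.2 y := hymax ⟨hx₁, fun j hj => (hz j hj).1⟩
    have h2 : coord p.2 x₂ ≤ coord p.2 y := hymax ⟨hx₂, fun j hj => (hz j hj).2⟩
    refine hext fun j => ?_
    by_cases hj : j = p.2
    · subst hj
      have h0 := hcomb p.2
      nlinarith [mul_le_mul_of_nonneg_left h2 hβ.le]
    · rw [hy0 j hj, (hz j hj).1]
  rw [← h.range_eq] at hyext
  obtain ⟨k, rfl⟩ := hyext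
  exact ⟨k, _, ht.trans_le hT, hyeq⟩

lemma exists_isEdge [Finite ι] [Fintype κ] [FiniteDimensional ℝ E] (p : ι × κ) :
    ∃ q, IsEdge v b p q := by
  obtain ⟨k, T, hT, hk⟩ := h.exists_vertex_eq_add p
  have hneg : v p.1 - v k = (-T) • b p.1 p.2 := by rw [hk, neg_smul]; abel
  have hnn : ∀ m, 0 ≤ (b k).repr ((-T) • b p.1 p.2) m := fun m => by
    rw [← hneg]; exact h.repr_nonneg k (vertex_mem v p.1) m
  obtain ⟨i, hi⟩ : ∃ i, (b k).repr ((-T) • b p.1 p.2) i ≠ 0 := by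
    by_contra! hcon
    have : (-T) • b p.1 p.2 = 0 :=
      (b k).repr.injective (Finsupp.ext fun m => by rw [hcon m, map_zero]; rfl)
    rcases smul_eq_zero.1 this with h0 | h0
    · linarith
    · exact (b p.1).ne_zero _ h0
  have hzero : ∀ j, j ≠ p.2 → (b p.1).repr (b k i) j = 0 := by
    intro j hj
    have hsum := (b k).repr_eq_sum_repr (b p.1) ((-T) • b p.1 p.2) j
    rw [Basis.repr_smul_self_of_ne _ _ hj] at hsum
    have := (Finset.sum_eq_zero_iff_of_nonneg fun m _ =>
      mul_nonneg (hnn m) (h.repr_nonneg_of_eq_add hk hj m)).1 hsum.symm i (Finset.mem_univ i)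
    exact (mul_eq_zero.1 this).resolve_left hi
  set c := (b p.1).repr (b k i) p.2 with hc
  have hbk : b k i = c • b p.1 p.2 := by
    refine (b p.1).repr.injective (Finsupp.ext fun j => ?_)
    by_cases hj : j = p.2
    · subst hj; simp [hc]
    · rw [hzero j hj, Basis.repr_smul_self_of_ne _ _ hj]
  have hc0 : c < 0 := by
    have h1 : c * (b k).repr (b p.1 p.2) i = 1 := by
      have := congrArg (fun x => (b k).repr x i) hbk
      simpa using this.symm
    have h2 : 0 ≤ -T * (b k).repr (b p.1 p.2) i := by simpa using hnn i
    by_contra! hc0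
    nlinarith
  exact ⟨(k, i), T, hT, -c, by linarith, hk, by simpa using hbk⟩

omit h in
lemma eq_of_mem_extremePoints {P : Set E} {x u : E} {s t : ℝ} (hx : x ∈ P)
    (hs : 0 < s) (ht : 0 < t) (h₁ : x + s • u ∈ Set.extremePoints ℝ P)
    (h₂ : x + t • u ∈ Set.extremePoints ℝ P) (hst : s < t) : x = x + s • u := by
  refine (mem_extremePoints_iff_left.1 h₁).2 x hx _ h₂.1
    ⟨1 - s / t, s / t, by rw [sub_pos, div_lt_one ht]; exact hst, by positivity, by ring, ?_⟩
  rw [smul_add, smul_smul, div_mul_cancel₀ _ ht.ne', ← add_assoc, ← add_smul]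
  simp

lemma isEdge_unique {p q q' : ι × κ} (hq : IsEdge v b p q) (hq' : IsEdge v b p q') : q = q' := by
  obtain ⟨T, hT, c, hc, h1, h2⟩ := hq
  obtain ⟨T', hT', c', hc', h1', h2'⟩ := hq'
  have hext : ∀ k, v k ∈ Set.extremePoints ℝ (convexHull ℝ (Set.range v)) := fun k =>
    h.range_eq ▸ ⟨k, rfl⟩
  have hne := (b p.1).ne_zero p.2
  have hTT : T = T' := by
    have e1 := hext q.1
    have e2 := hext q'.1
    rw [h1] at e1
    rw [h1'] at e2
    rcases lt_trichotomy T T' with hlt | heq | hlt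
    · have := eq_of_mem_extremePoints (vertex_mem v p.1) hT hT' e1 e2 hlt
      simp [hne, hT.ne'] at this
    · exact heq
    · have := eq_of_mem_extremePoints (vertex_mem v p.1) hT' hT e2 e1 hlt
      simp [hne, hT'.ne'] at this
  have hk : q.1 = q'.1 := h.injective (by rw [h1, h1', hTT])
  refine Prod.ext hk ?_
  obtain ⟨k, i⟩ := q
  obtain ⟨k', i'⟩ := q'
  simp only at hk h2 h2' ⊢
  subst hk
  by_contra hii
  have hcomb : b k i = (c / c') • b k i' := by
    rw [h2, h2', smul_neg, smul_smul, div_mul_cancel₀ _ hc'.ne']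
  have := congrArg (fun x => (b k).repr x i) hcomb
  simp only [Basis.repr_smul_self_of_ne _ _ hii] at this
  simp at this

lemma exists_perm_of_isEdge [Fintype κ] {p q : ι × κ} (hpq : IsEdge v b p q) :
    ∃ σ : Equiv.Perm κ, σ p.2 = q.2 ∧ ∀ j, j ≠ p.2 →
      ∃ c > 0, ∀ y, (b q.1).repr y (σ j) = c * (b p.1).repr y j := by
  classical
  have hqp := hpq.symm
  obtain ⟨T, hT, c, hc, h1, h2⟩ := hpq
  obtain ⟨T', hT', c', hc', h1', h2'⟩ := hqp
  have hA : ∀ j, j ≠ p.2 → ∀ m, 0 ≤ (b p.1).repr (b q.1 m) j := fun j hj m =>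
    h.repr_nonneg_of_eq_add h1 hj m
  have hB : ∀ j, j ≠ q.2 → ∀ m, 0 ≤ (b q.1).repr (b p.1 m) j := fun j hj m =>
    h.repr_nonneg_of_eq_add h1' hj m
  have hA0 : ∀ j, j ≠ p.2 → (b p.1).repr (b q.1 q.2) j = 0 := fun j hj => by
    rw [h2, ← neg_smul, Basis.repr_smul_self_of_ne _ _ hj]
  have hB0 : ∀ j, j ≠ q.2 → (b q.1).repr (b p.1 p.2) j = 0 := fun j hj => by
    rw [h2', ← neg_smul, Basis.repr_smul_self_of_ne _ _ hj]
  have key : ∀ j, j ≠ p.2 → ∃ m, m ≠ q.2 ∧ ∃ c > 0, ∀ y,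
      (b q.1).repr y m = c * (b p.1).repr y j := by
    intro j hj
    obtain ⟨m, hm⟩ : ∃ m, 0 < (b q.1).repr (b p.1 j) m * (b p.1).repr (b q.1 m) j := by
      by_contra! hcon
      have := (b q.1).repr_eq_sum_repr (b p.1) (b p.1 j) j
      have h0 := Finset.sum_nonpos fun m (_ : m ∈ Finset.univ) => hcon m
      rw [← this] at h0
      simp at h0
      linarith
    have hmq : m ≠ q.2 := by
      rintro rfl
      rw [hA0 j hj, mul_zero] at hm
      exact hm.false
    have hBpos : 0 < (b q.1).repr (b p.1 j) m :=
      pos_of_mul_pos_left hm (hA j hj m)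
    have hApos : 0 < (b p.1).repr (b q.1 m) j :=
      pos_of_mul_pos_right hm hBpos.le
    refine ⟨m, hmq, _, hBpos, fun y => ?_⟩
    have hz : ∀ l, l ≠ j → (b q.1).repr (b p.1 l) m = 0 := by
      intro l hl
      by_cases hlp : l = p.2
      · rw [hlp, hB0 m hmq]
      have hsum := (b q.1).repr_eq_sum_repr (b p.1) (b p.1 l) j
      have hl0 : (b p.1).repr (b p.1 l) j = 0 := by simp [hl]
      rw [hl0] at hsum
      have := (Finset.sum_eq_zero_iff_of_nonneg fun n _ => by
        by_cases hn : n = q.2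
        · rw [hn, hA0 j hj, mul_zero]
        · exact mul_nonneg (hB n hn l) (hA j hj n)).1 hsum.symm m (Finset.mem_univ m)
      exact (mul_eq_zero.1 this).resolve_right hApos.ne'
    rw [(b p.1).repr_eq_sum_repr (b q.1) y m, Finset.sum_eq_single j, mul_comm]
    · intro l _ hl
      rw [hz l hl, mul_zero]
    · simp
  choose! f hfq c₀ hc₀ hf using key
  have hinj : Function.Injective fun j => if j = p.2 then q.2 else f j := by
    intro j l hjl
    by_cases hj : j = p.2 <;> by_cases hl : l = p.2
    · rw [hj, hl]
    · simp only [hj, hl, if_true, if_false] at hjl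
      exact absurd hjl.symm (hfq l hl)
    · simp only [hj, hl, if_true, if_false] at hjl
      exact absurd hjl (hfq j hj)
    · simp only [hj, hl, if_false] at hjl
      by_contra hne
      have e1 := hf j hj (b p.1 j)
      rw [hjl, hf l hl] at e1
      have := hc₀ j hj
      simp [hne] at e1
      linarith
  refine ⟨Equiv.ofBijective _ (Finite.injective_iff_bijective.1 hinj), by simp, fun j hj => ?_⟩
  refine ⟨c₀ j, hc₀ j hj, fun y => ?_⟩
  simp [hj, hf j hj]

omit h in
lemma nnSign_mul_of_pos {c : ℝ} (hc : 0 < c) (x : ℝ) : nnSign (c * x) = nnSign x := by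
  simp [nnSign, mul_nonneg_iff_of_pos_left hc]

omit h in
lemma sign_mul_of_pos {c : ℝ} (hc : 0 < c) (x : ℝ) : Real.sign (c * x) = Real.sign x := by
  rcases lt_trichotomy x 0 with hx | rfl | hx
  · rw [Real.sign_of_neg hx, Real.sign_of_neg (mul_neg_of_pos_of_neg hc hx)]
  · simp
  · rw [Real.sign_of_pos hx, Real.sign_of_pos (mul_pos hc hx)]

variable [Fintype κ]

lemma prod_erase_eq_of_isEdge [DecidableEq κ] {p q : ι × κ} (hpq : IsEdge v b p q)
    {ξ : StrongDual ℝ E} (hξ : ξ (b p.1 p.2) = 0) (y : E) :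
    ∏ j ∈ Finset.univ.erase p.2, signFactor (b p.1) ξ (y - v p.1) j =
      ∏ j ∈ Finset.univ.erase q.2, signFactor (b q.1) ξ (y - v q.1) j := by
  obtain ⟨σ, hσ, hσc⟩ := h.exists_perm_of_isEdge hpq
  obtain ⟨T, hT, c, hc, h1, h2⟩ := hpq
  refine Finset.prod_equiv σ (fun j => by simp [← hσ]) fun j hj => ?_
  have hj : j ≠ p.2 := by simpa using hj
  obtain ⟨a, ha, hay⟩ := hσc j hj
  have hrepr : (b q.1).repr (y - v q.1) (σ j) = a * (b p.1).repr (y - v p.1) j := by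
    rw [hay, h1, show y - (v p.1 + T • b p.1 p.2) = (y - v p.1) - T • b p.1 p.2 by abel,
      map_sub, Finsupp.sub_apply, Basis.repr_smul_self_of_ne _ _ hj, sub_zero]
  have hξj : ξ (b p.1 j) = a * ξ (b q.1 (σ j)) := by
    conv_rhs => rw [← (b p.1).sum_repr (b q.1 (σ j))]
    rw [map_sum, Finset.sum_eq_single j]
    · have := hay (b q.1 (σ j))
      simp only [Basis.repr_self, Finsupp.single_eq_same] at this
      rw [map_smul, smul_eq_mul, ← mul_assoc, ← this, one_mul]
    · intro l _ hlj
      by_cases hl : l = p.2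
      · rw [hl, map_smul, hξ, smul_zero]
      · obtain ⟨a', ha', hay'⟩ := hσc l hl
        have := hay' (b q.1 (σ j))
        rw [Basis.repr_self, Finsupp.single_eq_of_ne (by simpa using hlj)] at this
        rw [(mul_eq_zero.1 this.symm).resolve_left ha'.ne', zero_smul, map_zero]
    · simp
  rw [signFactor, signFactor, hrepr, hξj, nnSign_mul_of_pos ha, sign_mul_of_pos ha]

lemma sum_edges_eq_zero [Fintype ι] [DecidableEq κ] [FiniteDimensional ℝ E]
    (ξ ξ₀ : StrongDual ℝ E) (y : E) :
    ∑ p : ι × κ, (if ξ₀ (b p.1 p.2) = 0 then Real.sign (ξ (b p.1 p.2)) / 2 *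
      ∏ j ∈ Finset.univ.erase p.2, signFactor (b p.1) ξ₀ (y - v p.1) j else 0) = 0 := by
  choose nbr hnbr using h.exists_isEdge
  have hinv : Function.Involutive nbr := fun p => h.isEdge_unique (hnbr (nbr p)) (hnbr p).symm
  set Q : ι × κ → ℝ := fun p => if ξ₀ (b p.1 p.2) = 0 then Real.sign (ξ (b p.1 p.2)) / 2 *
      ∏ j ∈ Finset.univ.erase p.2, signFactor (b p.1) ξ₀ (y - v p.1) j else 0 with hQ
  have hneg : ∀ p, Q (nbr p) = -Q p := by
    intro p
    have hprod := fun h0 => h.prod_erase_eq_of_isEdge (hnbr p) (ξ := ξ₀) h0 y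
    obtain ⟨T, hT, c, hc, h1, h2⟩ := hnbr p
    simp only [hQ]
    by_cases h0 : ξ₀ (b p.1 p.2) = 0
    · rw [if_pos h0, if_pos (by simp [h2, h0]), ← hprod h0, h2, map_neg, map_smul, smul_eq_mul,
        Real.sign_neg, sign_mul_of_pos hc]
      ring
    · rw [if_neg h0, if_neg (by simp [h2, h0, hc.ne']), neg_zero]
  have := Equiv.sum_comp hinv.toPerm Q
  simp only [Function.Involutive.coe_toPerm, hneg, Finset.sum_neg_distrib] at this
  linarith

omit h [NormedAddCommGroup E] [NormedSpace ℝ E] in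
lemma prod_sub_prod_eq [DecidableEq κ] {s s₀ e : κ → ℝ} (hs : ∀ i, s₀ i ≠ 0 → s i = s₀ i)
    (h₁ : ∀ i j, s₀ i = 0 → s₀ j = 0 → i = j) :
    ∏ i, (e i + s i) / 2 - ∏ i, (e i + s₀ i) / 2 = ∑ i, if s₀ i = 0 then
      s i / 2 * ∏ j ∈ Finset.univ.erase i, (e j + s₀ j) / 2 else 0 := by
  by_cases hz : ∃ i, s₀ i = 0
  · obtain ⟨i, hi⟩ := hz
    have hne : ∀ j, j ≠ i → s₀ j ≠ 0 := fun j hj h0 => hj (h₁ j i h0 hi)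
    rw [Finset.sum_eq_single i (fun j _ hj => if_neg (hne j hj)) (by simp), if_pos hi,
      ← Finset.mul_prod_erase _ _ (Finset.mem_univ i),
      ← Finset.mul_prod_erase _ (fun i => (e i + s₀ i) / 2) (Finset.mem_univ i),
      Finset.prod_congr rfl fun j hj => by rw [hs j (hne j (Finset.ne_of_mem_erase hj))], hi]
    ring
  · push Not at hz
    simp [hz, fun i => hs i (hz i)]

lemma lvSum_eq_of_sign_eq [Fintype ι] [FiniteDimensional ℝ E] {ξ ξ₀ : StrongDual ℝ E} (y : E)
    (hs : ∀ k i, ξ₀ (b k i) ≠ 0 → Real.sign (ξ (b k i)) = Real.sign (ξ₀ (b k i)))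
    (h₁ : ∀ k i j, ξ₀ (b k i) = 0 → ξ₀ (b k j) = 0 → i = j) :
    lvSum v b ξ y = lvSum v b ξ₀ y := by
  classical
  rw [← sub_eq_zero, lvSum, lvSum, ← Finset.sum_sub_distrib, ← h.sum_edges_eq_zero ξ ξ₀ y,
    Fintype.sum_prod_type]
  refine Finset.sum_congr rfl fun k _ => ?_
  have := prod_sub_prod_eq (e := fun i => nnSign ((b k).repr (y - v k) i))
    (s := fun i => Real.sign (ξ (b k i))) (s₀ := fun i => Real.sign (ξ₀ (b k i)))
    (fun i hi => hs k i (by simpa [Real.sign_eq_zero_iff] using hi))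
    (fun i j hi hj => h₁ k i j (Real.sign_eq_zero_iff.1 hi) (Real.sign_eq_zero_iff.1 hj))
  simpa only [signFactor, Real.sign_eq_zero_iff] using this

lemma lvSum_eq_of_line [Fintype ι] [FiniteDimensional ℝ E] {ξ ξ' : StrongDual ℝ E} (y : E)
    (hξ : ∀ k i j, i ≠ j → ξ (b k i) * ξ' (b k j) ≠ ξ (b k j) * ξ' (b k i)) :
    lvSum v b ξ y = lvSum v b ξ' y := by
  have hloc : IsLocallyConstant fun t : ℝ => lvSum v b (ξ + t • (ξ' - ξ)) y := by
    rw [IsLocallyConstant.iff_eventually_eq]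
    intro t₀
    have hev : ∀ᶠ t in nhds t₀, ∀ k i, (ξ + t₀ • (ξ' - ξ)) (b k i) ≠ 0 →
        Real.sign ((ξ + t • (ξ' - ξ)) (b k i)) = Real.sign ((ξ + t₀ • (ξ' - ξ)) (b k i)) := by
      rw [Filter.eventually_all]
      intro k
      rw [Filter.eventually_all]
      intro i
      have hc : Continuous fun t : ℝ => (ξ + t • (ξ' - ξ)) (b k i) := by
        simp only [add_apply, smul_apply]
        fun_prop
      rcases lt_trichotomy ((ξ + t₀ • (ξ' - ξ)) (b k i)) 0 with h0 | h0 | h0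
      · filter_upwards [hc.continuousAt.eventually_lt continuousAt_const h0] with t ht _
        rw [Real.sign_of_neg ht, Real.sign_of_neg h0]
      · exact Filter.Eventually.of_forall fun t h1 => absurd h0 h1
      · filter_upwards [continuousAt_const.eventually_lt hc.continuousAt h0] with t ht _
        rw [Real.sign_of_pos ht, Real.sign_of_pos h0]
    filter_upwards [hev] with t ht
    refine h.lvSum_eq_of_sign_eq y ht fun k i j hi hj => ?_
    by_contra hij
    simp only [add_apply, smul_apply, sub_apply, smul_eq_mul] at hi hj
    refine hξ k i j hij ?_
    rcases eq_or_ne t₀ 0 with rfl | ht₀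
    · have hi' : ξ (b k i) = 0 := by linarith
      have hj' : ξ (b k j) = 0 := by linarith
      rw [hi', hj']; ring
    · refine mul_left_cancel₀ ht₀ ?_
      linear_combination ξ (b k i) * hj - ξ (b k j) * hi
  have := hloc.apply_eq_of_preconnectedSpace 0 1
  simpa using this

lemma lvSum_eq_one [Fintype ι] [Nonempty ι] {ξ : StrongDual ℝ E} (hξ : ∀ k i, ξ (b k i) ≠ 0)
    {y : E} (hy : y ∈ convexHull ℝ (Set.range v)) : lvSum v b ξ y = 1 := by
  obtain ⟨k, hk⟩ := Finite.exists_min fun k => ξ (v k)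
  have hmin : ∀ z ∈ convexHull ℝ (Set.range v), ξ (v k) ≤ ξ z := by
    have hconv : Convex ℝ {z | ξ (v k) ≤ ξ z} :=
      convex_halfSpace_ge (ξ : E →ₗ[ℝ] ℝ).isLinear _
    exact fun z hz => convexHull_min (by rintro _ ⟨l, rfl⟩; exact hk l) hconv hz
  have hpos : ∀ i, 0 < ξ (b k i) := by
    intro i
    obtain ⟨t, ht, hm⟩ := h.exists_add_smul_mem k i
    have := hmin _ hm
    rw [map_add, map_smul, smul_eq_mul] at this
    exact (nonneg_of_mul_nonneg_right (by linarith) ht).lt_of_ne' (hξ k i)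
  have hnn : ∀ l i, nnSign ((b l).repr (y - v l) i) = 1 := fun l i =>
    if_pos (h.repr_nonneg l hy i)
  rw [lvSum, Finset.sum_eq_single k]
  · refine Finset.prod_eq_one fun i _ => ?_
    rw [signFactor, hnn, Real.sign_of_pos (hpos i)]
    norm_num
  · intro l _ hlk
    obtain ⟨i, hi⟩ : ∃ i, ξ (b l i) < 0 := by
      by_contra! hcon
      have hz : ∀ i, ((b l).repr (v k - v l) i) * ξ (b l i) = 0 := by
        have hsum : ξ (v k - v l) = ∑ i, (b l).repr (v k - v l) i * ξ (b l i) := by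
          conv_lhs => rw [← (b l).sum_repr (v k - v l)]
          simp [map_sum]
        have hterm : ∀ i ∈ Finset.univ, 0 ≤ (b l).repr (v k - v l) i * ξ (b l i) := fun i _ =>
          mul_nonneg (h.repr_nonneg l (vertex_mem v k) i) (hcon i)
        have := hk l
        have hle : ξ (v k - v l) ≤ 0 := by rw [map_sub]; linarith
        have h0 := le_antisymm (hsum ▸ hle) (Finset.sum_nonneg hterm)
        exact fun i => (Finset.sum_eq_zero_iff_of_nonneg hterm).1 h0 i (Finset.mem_univ i)
      have hvv : v k - v l = 0 := (b l).repr.injective <| Finsupp.ext fun i => by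
        rw [(mul_eq_zero.1 (hz i)).resolve_right (hξ l i), map_zero]; rfl
      exact hlk (h.injective (sub_eq_zero.1 hvv).symm)
    refine Finset.prod_eq_zero (Finset.mem_univ i) ?_
    rw [signFactor, hnn, Real.sign_of_neg hi]
    norm_num
  · simp

omit h in
lemma lvSum_eq_zero_of_lt [Fintype ι] {ξ : StrongDual ℝ E} (hξ : ∀ k i, ξ (b k i) ≠ 0)
    {y : E} (hy : ∀ k, ξ y < ξ (v k)) : lvSum v b ξ y = 0 := by
  refine Finset.sum_eq_zero fun k _ => ?_
  by_contra hne
  have hsum : ξ (y - v k) = ∑ i, (b k).repr (y - v k) i * ξ (b k i) := by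
    conv_lhs => rw [← (b k).sum_repr (y - v k)]
    simp [map_sum]
  have hnn : 0 ≤ ξ (y - v k) := by
    rw [hsum]
    refine Finset.sum_nonneg fun i _ => ?_
    have hi := Finset.prod_ne_zero_iff.1 hne i (Finset.mem_univ i)
    rw [signFactor, nnSign] at hi
    rcases (hξ k i).lt_or_gt with hneg | hpos
    · rw [Real.sign_of_neg hneg] at hi
      split_ifs at hi with hr
      · norm_num at hi
      · exact mul_nonneg_of_nonpos_of_nonpos (not_le.1 hr).le hneg.le
    · rw [Real.sign_of_pos hpos] at hi
      split_ifs at hi with hr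
      · exact mul_nonneg hr hpos.le
      · norm_num at hi
  rw [map_sub] at hnn
  linarith [hy k]

omit h [Fintype κ] in
lemma dense_setOf_apply_ne_zero {u : E} (hu : u ≠ 0) : Dense {ξ : StrongDual ℝ E | ξ u ≠ 0} := by
  obtain ⟨g, hg⟩ := exists_dual_vector'' ℝ u
  have hgu : g u ≠ 0 := by rw [hg.2]; simpa using hu
  intro ξ
  by_cases h0 : ξ u = 0
  · have hlim : Filter.Tendsto (fun t : ℝ => ξ + t • g) (nhdsWithin 0 {0}ᶜ) (nhds ξ) := by
      have : Continuous fun t : ℝ => ξ + t • g := by fun_prop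
      have h1 := this.tendsto 0
      simp only [zero_smul, add_zero] at h1
      exact h1.mono_left nhdsWithin_le_nhds
    refine mem_closure_of_tendsto hlim ?_
    filter_upwards [self_mem_nhdsWithin] with t ht
    simpa [h0, hgu] using ht
  · exact subset_closure h0

omit h [Fintype κ] in
lemma dense_setOf_forall_apply_ne_zero {α : Type*} [Finite α] {u : α → E} (hu : ∀ a, u a ≠ 0) :
    Dense {ξ : StrongDual ℝ E | ∀ a, ξ (u a) ≠ 0} := by
  have := dense_iInter_of_isOpen (f := fun a => {ξ : StrongDual ℝ E | ξ (u a) ≠ 0})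
    (fun a => isOpen_ne_fun (by fun_prop) continuous_const)
    fun a => dense_setOf_apply_ne_zero (hu a)
  simpa only [← Set.ofPred_forall] using this

theorem lvSum_eq_zero [Fintype ι] [FiniteDimensional ℝ E] {ξ : StrongDual ℝ E}
    (hξ : ∀ k i, ξ (b k i) ≠ 0) {y : E} (hy : y ∉ convexHull ℝ (Set.range v)) :
    lvSum v b ξ y = 0 := by
  have hclosed : IsClosed (convexHull ℝ (Set.range v)) :=
    ((Set.finite_range v).isCompact_convexHull (𝕜 := ℝ)).isClosed
  obtain ⟨f, u, hfy, hf⟩ := geometric_hahn_banach_point_closed (convex_convexHull ℝ _) hclosed hy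
  let w : (ι × κ) ⊕ {p : ι × κ × κ // p.2.1 ≠ p.2.2} → E := Sum.elim (fun p => b p.1 p.2)
    fun p => ξ (b p.1.1 p.1.2.1) • b p.1.1 p.1.2.2 - ξ (b p.1.1 p.1.2.2) • b p.1.1 p.1.2.1
  have hw : ∀ a, w a ≠ 0 := by
    rintro (p | ⟨⟨k, i, j⟩, hij⟩)
    · exact (b p.1).ne_zero p.2
    · intro h0
      have h1 := congrArg (fun x => (b k).repr x j) h0
      simp only [w, Sum.elim_inr, map_sub, Finsupp.sub_apply,
        Basis.repr_smul_self_of_ne _ _ (Ne.symm hij)] at h1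
      simp [hξ k i] at h1
  have hopen : IsOpen {η : StrongDual ℝ E | ∀ k, η y < η (v k)} := by
    simp only [Set.ofPred_forall]
    exact isOpen_iInter_of_finite fun k => isOpen_lt (by fun_prop) (by fun_prop)
  obtain ⟨η, hη, hηw⟩ := (dense_setOf_forall_apply_ne_zero hw).inter_open_nonempty _ hopen
    ⟨f, fun k => hfy.trans (hf _ (vertex_mem v k))⟩
  rw [h.lvSum_eq_of_line (ξ' := η) y]
  · exact lvSum_eq_zero_of_lt (fun k i => hηw (Sum.inl (k, i))) hη
  · intro k i j hij h0
    have := hηw (Sum.inr ⟨(k, i, j), hij⟩)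
    simp only [w, Sum.elim_inr, map_sub, map_smul, smul_eq_mul] at this
    exact this (sub_eq_zero.2 h0)

end IsSimplePolytope

end Geometry

section Series

open Module

variable {d : ℕ}

/-- The series `x^u · S`. -/
def shiftSeries (u : Fin d → ℤ) : ((Fin d → ℤ) → ℂ) →ₗ[ℂ] ((Fin d → ℤ) → ℂ) :=
  LinearMap.funLeft ℂ ℂ (· - u)

lemma shiftSeries_apply (u : Fin d → ℤ) (S : (Fin d → ℤ) → ℂ) (m : Fin d → ℤ) :
    shiftSeries u S m = S (m - u) := rfl

lemma toR_sub (m u : Fin d → ℤ) : toR d (m - u) = toR d m - toR d u := by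
  ext i; simp [toR]

lemma actLP_single (u : Fin d → ℤ) (c : ℂ) (S : (Fin d → ℤ) → ℂ) :
    actLP d (Finsupp.single u c) S = c • shiftSeries u S := by
  ext m
  change (Finsupp.single u c).sum (fun w a => a * S (m - w)) = c * S (m - u)
  exact Finsupp.sum_single_index (zero_mul _)

lemma toRat_single (u : Fin d → ℤ) (c : ℂ) :
    toRat d (Finsupp.single u c) =
      algebraMap (MvPolynomial (Fin d) ℂ) (RatF d) (MvPolynomial.C c) * ratMon d u := by
  change (Finsupp.single u c).sum
    (fun w a => algebraMap (MvPolynomial (Fin d) ℂ) (RatF d) (MvPolynomial.C a) * ratMon d w) = _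
  exact Finsupp.sum_single_index (by simp)

lemma ratMon_zero : ratMon d 0 = 1 := by simp [ratMon]

lemma ratMon_ne_one {u : Fin d → ℤ} (hu : u ≠ 0) : ratMon d u ≠ 1 := by
  intro h1
  set X : Fin d → RatF d := fun i =>
    algebraMap (MvPolynomial (Fin d) ℂ) (RatF d) (MvPolynomial.X i) with hX
  have hX0 : ∀ i, X i ≠ 0 := fun i => by
    simp [hX]
  have hmul : ratMon d u * ∏ i, X i ^ (-u i).toNat = ∏ i, X i ^ (u i).toNat := by
    rw [ratMon, ← Finset.prod_mul_distrib]
    refine Finset.prod_congr rfl fun i _ => ?_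
    rw [← zpow_natCast, ← zpow_natCast, ← zpow_add₀ (hX0 i)]
    congr 1
    omega
  have hmon : ∀ a : Fin d → ℕ, ∏ i, X i ^ a i = algebraMap (MvPolynomial (Fin d) ℂ) (RatF d)
      (MvPolynomial.monomial (Finsupp.equivFunOnFinite.symm a) 1) := by
    intro a
    rw [MvPolynomial.monomial_eq, map_one, one_mul, Finsupp.prod_fintype _ _ (by simp), map_prod]
    simp [hX]
  rw [h1, one_mul, hmon, hmon] at hmul
  have := MvPolynomial.monomial_left_injective (one_ne_zero (α := ℂ))
    (IsFractionRing.injective (MvPolynomial (Fin d) ℂ) (RatF d) hmul)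
  refine hu (funext fun i => ?_)
  have := congrFun (Finsupp.equivFunOnFinite.symm.injective this) i
  simp only [Pi.zero_apply]
  omega

/-- The `ℂ`-span of the series of simple rational cones. -/
def coneSpan (d : ℕ) : Submodule ℂ ((Fin d → ℤ) → ℂ) :=
  Submodule.span ℂ {S | ∃ (v : Fin d → ℝ) (w : Fin d → Fin d → ℤ),
    LinearIndependent ℝ (fun i => toR d (w i)) ∧ S = genSeries d (coneSet d d v w)}

lemma genSeries_coneSet_mem (v : Fin d → ℝ) {w : Fin d → Fin d → ℤ}
    (hw : LinearIndependent ℝ (fun i => toR d (w i))) :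
    genSeries d (coneSet d d v w) ∈ coneSpan d :=
  Submodule.subset_span ⟨v, w, hw, rfl⟩

lemma memPL_of_mem_coneSpan {S : (Fin d → ℤ) → ℂ} (hS : S ∈ coneSpan d) : MemPL d S := by
  obtain ⟨n, f, g, rfl⟩ := Submodule.mem_span_set'.1 hS
  choose v w hw hg using fun i => (g i).2
  refine ⟨n, fun i => Finsupp.single 0 (f i), fun i => coneSet d d (v i) (w i),
    fun i => ⟨v i, w i, hw i, rfl⟩, Finset.sum_congr rfl fun i _ => ?_⟩
  rw [actLP_single, hg i]
  congr 1
  ext m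
  rw [shiftSeries_apply, sub_zero]

lemma shiftSeries_mem (u : Fin d → ℤ) {S : (Fin d → ℤ) → ℂ} (hS : S ∈ coneSpan d) :
    shiftSeries u S ∈ coneSpan d := by
  refine Submodule.span_le (p := (coneSpan d).comap (shiftSeries u)) |>.2 ?_ hS
  rintro _ ⟨v, w, hw, rfl⟩
  have : shiftSeries u (genSeries d (coneSet d d v w)) =
      genSeries d (coneSet d d (v + toR d u) w) := by
    ext m
    rw [shiftSeries_apply, genSeries, genSeries, toR_sub]
    congr 1
    refine propext (exists_congr fun lam => and_congr_right fun _ => ?_)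
    rw [sub_eq_iff_eq_add, add_right_comm]
  rw [SetLike.mem_coe, Submodule.mem_comap, this]
  exact genSeries_coneSet_mem _ hw

namespace IsPhi

variable {φ : ((Fin d → ℤ) → ℂ) → RatF d} (hφ : IsPhi d φ)
include hφ

lemma map_add {S T : (Fin d → ℤ) → ℂ} (hS : S ∈ coneSpan d) (hT : T ∈ coneSpan d) :
    φ (S + T) = φ S + φ T :=
  hφ.1 S T (memPL_of_mem_coneSpan hS) (memPL_of_mem_coneSpan hT)

lemma map_zero : φ 0 = 0 := by
  simpa using hφ.map_add (coneSpan d).zero_mem (coneSpan d).zero_mem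

lemma map_shiftSeries (u : Fin d → ℤ) {S : (Fin d → ℤ) → ℂ} (hS : S ∈ coneSpan d) :
    φ (shiftSeries u S) = ratMon d u * φ S := by
  have := hφ.2.1 (Finsupp.single u 1) S (memPL_of_mem_coneSpan hS)
  simpa [actLP_single, toRat_single] using this

lemma map_neg {S : (Fin d → ℤ) → ℂ} (hS : S ∈ coneSpan d) : φ (-S) = -φ S := by
  have := hφ.map_add hS ((coneSpan d).neg_mem hS)
  rw [add_neg_cancel, hφ.map_zero] at this
  exact (neg_eq_of_add_eq_zero_right this.symm).symm

lemma map_neg_one_pow_smul (n : ℕ) {S : (Fin d → ℤ) → ℂ} (hS : S ∈ coneSpan d) :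
    φ ((-1 : ℂ) ^ n • S) = (-1) ^ n * φ S := by
  rcases neg_one_pow_eq_or ℤ n with h | h
  · have e (R : Type) [CommRing R] : (-1 : R) ^ n = 1 := by
      exact_mod_cast congrArg (Int.cast (R := R)) h
    rw [e, e, one_smul, one_mul]
  · have e (R : Type) [CommRing R] : (-1 : R) ^ n = -1 := by
      exact_mod_cast congrArg (Int.cast (R := R)) h
    rw [e, e, neg_smul, one_smul, neg_one_mul, hφ.map_neg hS]

lemma map_sum {α : Type*} (s : Finset α) {S : α → (Fin d → ℤ) → ℂ}
    (hS : ∀ a ∈ s, S a ∈ coneSpan d) : φ (∑ a ∈ s, S a) = ∑ a ∈ s, φ (S a) := by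
  induction s using Finset.induction_on with
  | empty => simpa using hφ.map_zero
  | insert a s ha ih =>
    rw [Finset.sum_insert ha, Finset.sum_insert ha, hφ.map_add (hS a (Finset.mem_insert_self a s))
      ((coneSpan d).sum_mem fun c hc => hS c (Finset.mem_insert_of_mem hc)),
      ih fun c hc => hS c (Finset.mem_insert_of_mem hc)]

lemma eq_zero_of_shiftSeries_eq {u : Fin d → ℤ} (hu : u ≠ 0) {S : (Fin d → ℤ) → ℂ}
    (hS : S ∈ coneSpan d) (h : shiftSeries u S = S) : φ S = 0 := by
  have := hφ.map_shiftSeries u hS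
  rw [h] at this
  by_contra h0
  exact ratMon_ne_one hu (mul_right_cancel₀ h0 (by rw [← this, one_mul]))

end IsPhi

/-- The basis of `ℝ^d` formed by linearly independent integer vectors. -/
def edgeBasis {w : Fin d → Fin d → ℤ} (hw : LinearIndependent ℝ (fun i => toR d (w i))) :
    Basis (Fin d) ℝ (Fin d → ℝ) :=
  basisOfLinearIndependentOfCardEqFinrank' _ hw (by simp)

section Cones

variable {w : Fin d → Fin d → ℤ} (hw : LinearIndependent ℝ (fun i => toR d (w i)))
  (v : Fin d → ℝ)

@[simp]
lemma edgeBasis_apply (i : Fin d) : edgeBasis hw i = toR d (w i) := by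
  simp [edgeBasis]

lemma eq_add_sum_iff {y : Fin d → ℝ} {lam : Fin d → ℝ} :
    y = v + ∑ i, lam i • toR d (w i) ↔ ∀ i, (edgeBasis hw).repr (y - v) i = lam i := by
  have hsum : ∑ i, lam i • toR d (w i) = (edgeBasis hw).equivFun.symm lam := by
    simp [Basis.equivFun_symm_apply]
  rw [hsum, ← sub_eq_iff_eq_add', LinearEquiv.eq_symm_apply, funext_iff]
  rfl

/-- The half-open cone at `v` in which the coordinates in `I` are negative and the other ones are
nonnegative. -/
def halfOpenCone (I : Finset (Fin d)) : Set (Fin d → ℝ) :=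
  {y | ∀ i, if i ∈ I then (edgeBasis hw).repr (y - v) i < 0 else 0 ≤ (edgeBasis hw).repr (y - v) i}

lemma mem_coneSet_iff {y : Fin d → ℝ} :
    y ∈ coneSet d d v w ↔ ∀ i, 0 ≤ (edgeBasis hw).repr (y - v) i := by
  simp only [coneSet, Set.mem_ofPred_eq, eq_add_sum_iff hw]
  exact ⟨fun ⟨lam, h0, h⟩ i => h i ▸ h0 i, fun h => ⟨_, h, fun _ => rfl⟩⟩

lemma lvCone_eq_halfOpenCone {xi : Fin d → ℝ} (hxi : ∀ i, dotR d xi (toR d (w i)) ≠ 0)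
    {I : Finset (Fin d)} (hI : ∀ i, i ∈ I ↔ dotR d xi (toR d (w i)) < 0) :
    lvCone d v w xi = halfOpenCone hw v I := by
  ext y
  constructor
  · rintro ⟨lam, h0, h⟩ i
    rw [eq_add_sum_iff hw] at h
    split_ifs with hi
    · exact h i ▸ (h0 i).2 ((hI i).1 hi)
    · exact h i ▸ (h0 i).1 (lt_of_le_of_ne (not_lt.1 fun hlt => hi ((hI i).2 hlt)) (hxi i).symm)
  · intro h
    refine ⟨fun i => (edgeBasis hw).repr (y - v) i, fun i => ⟨fun hi => ?_, fun hi => ?_⟩,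
      (eq_add_sum_iff hw v).2 fun _ => rfl⟩
    · simpa [hI, hi.le.not_gt] using h i
    · simpa [hI, hi] using h i

lemma exists_denominator_repr : ∃ D : ℤ, D ≠ 0 ∧ ∀ (m : Fin d → ℤ) (i : Fin d),
    ∃ n : ℤ, (D : ℝ) * (edgeBasis hw).repr (toR d m) i = n := by
  let W : Matrix (Fin d) (Fin d) ℤ := Matrix.of w
  let WR : Matrix (Fin d) (Fin d) ℝ := W.map (Int.castRingHom ℝ)
  have hdet : ((W.det : ℤ) : ℝ) = WR.det := RingHom.map_det (Int.castRingHom ℝ) W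
  have hli : LinearIndependent ℝ WR.row := hw
  refine ⟨W.det, ?_, fun m i => ⟨Matrix.vecMul m W.adjugate i, ?_⟩⟩
  · have := (Matrix.isUnit_iff_isUnit_det _).1 (Matrix.linearIndependent_rows_iff_isUnit.1 hli)
    intro h0
    rw [← hdet, h0] at this
    simp at this
  · set lam := (edgeBasis hw).equivFun (toR d m)
    have hm : Matrix.vecMul lam WR = toR d m := by
      have := (edgeBasis hw).sum_equivFun (toR d m)
      rw [← this, Matrix.vecMul_eq_sum]
      refine Finset.sum_congr rfl fun j _ => ?_
      rw [edgeBasis_apply]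
      rfl
    have hadj : WR.adjugate = W.adjugate.map (Int.castRingHom ℝ) :=
      (RingHom.map_adjugate (Int.castRingHom ℝ) W).symm
    have h1 : Matrix.vecMul (toR d m) WR.adjugate = WR.det • lam := by
      rw [← hm, Matrix.vecMul_vecMul, Matrix.mul_adjugate, Matrix.vecMul_smul, Matrix.vecMul_one]
    have h2 := congrFun h1 i
    rw [← hdet, Pi.smul_apply, smul_eq_mul] at h2
    change (W.det : ℝ) * lam i = _
    rw [← h2, hadj]
    simp [Matrix.vecMul, dotProduct, toR]

lemma exists_gap (i : Fin d) : ∃ ε > 0, ∀ m : Fin d → ℤ,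
    (edgeBasis hw).repr (toR d m - v) i < 0 → (edgeBasis hw).repr (toR d m - v) i ≤ -ε := by
  obtain ⟨D, hD, hDn⟩ := exists_denominator_repr hw
  set c := (edgeBasis hw).repr v i with hc
  have hD' : (0 : ℝ) < |(D : ℝ)| := by positivity
  refine ⟨c - (⌈c * |(D : ℝ)|⌉ - 1) / |(D : ℝ)|, ?_, fun m hm => ?_⟩
  · rw [gt_iff_lt, sub_pos, div_lt_iff₀ hD']
    linarith [Int.ceil_lt_add_one (c * |(D : ℝ)|)]
  · obtain ⟨n', hn'⟩ : ∃ n' : ℤ, |(D : ℝ)| * (edgeBasis hw).repr (toR d m) i = n' := by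
      obtain ⟨n, hn⟩ := hDn m i
      rcases abs_choice (D : ℝ) with h | h
      · exact ⟨n, by rw [h, hn]⟩
      · exact ⟨-n, by rw [h, neg_mul, hn, Int.cast_neg]⟩
    rw [_root_.map_sub, Finsupp.sub_apply, ← hc] at hm ⊢
    have hlt : (n' : ℝ) < c * |(D : ℝ)| := by rw [← hn']; nlinarith
    have hle : n' + 1 ≤ ⌈c * |(D : ℝ)|⌉ := Int.add_one_le_iff.2 (Int.lt_ceil.2 hlt)
    have hle' : (n' : ℝ) + 1 ≤ ⌈c * |(D : ℝ)|⌉ := by exact_mod_cast hle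
    have : (edgeBasis hw).repr (toR d m) i ≤ (⌈c * |(D : ℝ)|⌉ - 1) / |(D : ℝ)| := by
      rw [le_div_iff₀ hD', mul_comm, hn']
      linarith
    linarith

lemma genSeries_halfOpenCone_mem (I : Finset (Fin d)) :
    genSeries d (halfOpenCone hw v I) ∈ coneSpan d := by
  choose ε hε hgap using exists_gap hw v
  set s : Fin d → ℤˣ := fun i => if i ∈ I then -1 else 1 with hs
  set e : Fin d → ℝ := fun i => if i ∈ I then ε i else 0 with he
  set w' : Fin d → Fin d → ℤ := fun i => (s i : ℤ) • w i with hw'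
  have htoR : ∀ i, toR d (w' i) = ((s i : ℤ) : ℝ) • toR d (w i) := fun i => by
    ext j; simp [toR, hw']
  have hs2 : ∀ i, ((s i : ℤ) : ℝ) * ((s i : ℤ) : ℝ) = 1 := fun i => by
    simp only [hs]; split_ifs <;> simp
  have hli : LinearIndependent ℝ fun i => toR d (w' i) := by
    have := hw.units_smul fun i => Units.map (Int.castRingHom ℝ).toMonoidHom (s i)
    convert this using 2 with i
    rw [htoR]
    rfl
  have hmem : ∀ y, y ∈ coneSet d d (v - ∑ i, e i • toR d (w i)) w' ↔
      ∀ i, 0 ≤ ((s i : ℤ) : ℝ) * ((edgeBasis hw).repr (y - v) i + e i) := by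
    intro y
    have hsplit : ∀ lam : Fin d → ℝ,
        v - ∑ i, e i • toR d (w i) + ∑ i, lam i • toR d (w' i) =
          v + ∑ i, (((s i : ℤ) : ℝ) * lam i - e i) • toR d (w i) := by
      intro lam
      rw [sub_add_eq_add_sub, add_sub_assoc, ← Finset.sum_sub_distrib]
      congr 1
      refine Finset.sum_congr rfl fun i _ => ?_
      rw [htoR, smul_smul, sub_smul, mul_comm]
    simp only [coneSet, Set.mem_ofPred_eq, hsplit, eq_add_sum_iff hw]
    constructor
    · rintro ⟨lam, h0, h⟩ i
      rw [h i, sub_add_cancel, ← mul_assoc, hs2, one_mul]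
      exact h0 i
    · intro h
      refine ⟨_, h, fun i => ?_⟩
      rw [← mul_assoc, hs2, one_mul, add_sub_cancel_right]
  have heq : genSeries d (halfOpenCone hw v I) =
      genSeries d (coneSet d d (v - ∑ i, e i • toR d (w i)) w') := by
    ext m
    rw [genSeries, genSeries]
    congr 1
    rw [hmem]
    refine propext (forall_congr' fun i => ?_)
    by_cases hi : i ∈ I
    · simp only [hs, he, if_pos hi]
      refine ⟨fun h => ?_, fun h => ?_⟩
      · have := hgap i m h
        push_cast
        linarith
      · push_cast at h
        linarith [hε i]
    · simp [hs, he, hi]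
  rw [heq]
  exact genSeries_coneSet_mem _ hli

lemma genSeries_halfOpenCone_insert_add {I : Finset (Fin d)} {i : Fin d} (hi : i ∉ I) :
    genSeries d (halfOpenCone hw v (insert i I)) + genSeries d (halfOpenCone hw v I) =
      genSeries d {y | ∀ j, j ≠ i → if j ∈ I then (edgeBasis hw).repr (y - v) j < 0
        else 0 ≤ (edgeBasis hw).repr (y - v) j} := by
  have hins : ∀ y, y ∈ halfOpenCone hw v (insert i I) ↔ (edgeBasis hw).repr (y - v) i < 0 ∧
      ∀ j, j ≠ i → if j ∈ I then (edgeBasis hw).repr (y - v) j < 0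
        else 0 ≤ (edgeBasis hw).repr (y - v) j := by
    intro y
    refine ⟨fun h => ⟨by simpa using h i, fun j hj => by simpa [hj] using h j⟩, fun h j => ?_⟩
    by_cases hj : j = i
    · simpa [hj] using h.1
    · simpa [hj] using h.2 j hj
  have hnot : ∀ y, y ∈ halfOpenCone hw v I ↔ 0 ≤ (edgeBasis hw).repr (y - v) i ∧
      ∀ j, j ≠ i → if j ∈ I then (edgeBasis hw).repr (y - v) j < 0
        else 0 ≤ (edgeBasis hw).repr (y - v) j := by
    intro y
    refine ⟨fun h => ⟨by simpa [hi] using h i, fun j _ => h j⟩, fun h j => ?_⟩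
    by_cases hj : j = i
    · simpa [hj, hi] using h.1
    · exact h.2 j hj
  ext m
  simp only [Pi.add_apply, genSeries, hins, hnot, Set.mem_ofPred_eq]
  rcases lt_or_ge ((edgeBasis hw).repr (toR d m - v) i) 0 with h0 | h0
  · simp only [h0, h0.not_ge, true_and, false_and, if_false, add_zero]
    congr
  · simp only [h0, h0.not_gt, true_and, false_and, if_false, zero_add]
    congr

lemma IsPhi.map_halfOpenCone_insert {φ : ((Fin d → ℤ) → ℂ) → RatF d} (hφ : IsPhi d φ)
    {I : Finset (Fin d)} {i : Fin d} (hi : i ∉ I) :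
    φ (genSeries d (halfOpenCone hw v (insert i I))) = -φ (genSeries d (halfOpenCone hw v I)) := by
  have h1 := genSeries_halfOpenCone_mem hw v (insert i I)
  have h2 := genSeries_halfOpenCone_mem hw v I
  rw [eq_neg_iff_add_eq_zero, ← hφ.map_add h1 h2]
  refine hφ.eq_zero_of_shiftSeries_eq (u := w i) ?_ ((coneSpan d).add_mem h1 h2) ?_
  · intro h0
    exact hw.ne_zero i (by ext j; simp [toR, h0])
  · rw [genSeries_halfOpenCone_insert_add hw v hi]
    ext m
    rw [shiftSeries_apply, genSeries, genSeries]
    congr 1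
    refine propext (forall₂_congr fun j hj => ?_)
    have : (edgeBasis hw).repr (toR d (m - w i) - v) j = (edgeBasis hw).repr (toR d m - v) j := by
      rw [toR_sub, sub_right_comm, ← edgeBasis_apply hw i, _root_.map_sub, Finsupp.sub_apply,
        Basis.repr_self, Finsupp.single_eq_of_ne hj, sub_zero]
    rw [this]

lemma IsPhi.map_halfOpenCone {φ : ((Fin d → ℤ) → ℂ) → RatF d} (hφ : IsPhi d φ)
    (I : Finset (Fin d)) : (-1) ^ I.card * φ (genSeries d (halfOpenCone hw v I)) =
      φ (genSeries d (halfOpenCone hw v ∅)) := by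
  induction I using Finset.induction_on with
  | empty => simp
  | insert i I hi ih =>
    rw [hφ.map_halfOpenCone_insert hw v hi, Finset.card_insert_of_notMem hi, ← ih]
    ring

end Cones

/-- The series of the integer points of the face `x_i = 0` (`i ∈ A`) of the positive orthant. -/
def orthantFace (A : Finset (Fin d)) : (Fin d → ℤ) → ℂ :=
  fun m => if (∀ i, 0 ≤ m i) ∧ ∀ i ∈ A, m i = 0 then 1 else 0

lemma toR_single (i : Fin d) : toR d (Pi.single i 1) = Pi.single i 1 := by
  ext j; simp [toR, Pi.single_apply]

lemma linearIndependent_toR_single :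
    LinearIndependent ℝ fun i : Fin d => toR d (Pi.single i 1) := by
  simpa only [toR_single] using Pi.linearIndependent_single_one (Fin d) ℝ

lemma eq_zero_add_sum_single_iff {m : Fin d → ℤ} {lam : Fin d → ℝ} :
    toR d m = 0 + ∑ i, lam i • toR d (Pi.single i 1) ↔ ∀ i, (m i : ℝ) = lam i := by
  simp only [toR_single, zero_add, funext_iff]
  simp [toR, Finset.sum_apply, Pi.single_apply]

lemma orthantFace_empty :
    orthantFace (d := d) ∅ = genSeries d (coneSet d d 0 fun i => Pi.single i 1) := by
  ext m
  rw [orthantFace, genSeries]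
  congr 1
  simp only [coneSet, Set.mem_ofPred_eq, eq_zero_add_sum_single_iff, eq_iff_iff]
  refine ⟨fun h => ⟨fun i => m i, fun i => Int.cast_nonneg (h.1 i), fun i => rfl⟩, ?_⟩
  rintro ⟨lam, h0, h⟩
  exact ⟨fun i => by exact_mod_cast (h i).symm ▸ h0 i, by simp⟩

lemma orthantFace_insert {A : Finset (Fin d)} {i : Fin d} (hi : i ∉ A) :
    orthantFace (insert i A) + shiftSeries (Pi.single i 1) (orthantFace A) = orthantFace A := by
  ext m
  have hA : ∀ j ∈ A, j ≠ i := fun j hj hji => hi (hji ▸ hj)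
  have hshift : ((∀ j, 0 ≤ (m - Pi.single i 1 : Fin d → ℤ) j) ∧
      ∀ j ∈ A, (m - Pi.single i 1 : Fin d → ℤ) j = 0) ↔
      1 ≤ m i ∧ (∀ j, 0 ≤ m j) ∧ ∀ j ∈ A, m j = 0 := by
    constructor
    · rintro ⟨h1, h2⟩
      have hmi : 1 ≤ m i := by simpa using h1 i
      refine ⟨hmi, fun j => ?_, fun j hj => by simpa [hA j hj] using h2 j hj⟩
      by_cases hj : j = i
      · subst hj; omega
      · simpa [hj] using h1 j
    · rintro ⟨h0, h1, h2⟩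
      refine ⟨fun j => ?_, fun j hj => by simpa [hA j hj] using h2 j hj⟩
      by_cases hj : j = i
      · subst hj; simpa using h0
      · simpa [hj] using h1 j
  simp only [Pi.add_apply, shiftSeries_apply, orthantFace, hshift, Finset.forall_mem_insert]
  by_cases h : (∀ j, 0 ≤ m j) ∧ ∀ j ∈ A, m j = 0
  · rcases (h.1 i).eq_or_lt with h0 | h0
    · simp [h, ← h0]
    · have h1 : 1 ≤ m i := h0
      simp [h.1, h0.ne', h1]
  · have h' : ¬((∀ j, 0 ≤ m j) ∧ m i = 0 ∧ ∀ j ∈ A, m j = 0) := fun h1 => h ⟨h1.1, h1.2.2⟩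
    simp only [if_neg h', h, and_false, if_false, add_zero]

lemma orthantFace_univ : orthantFace (Finset.univ : Finset (Fin d)) = Pi.single 0 1 := by
  ext m
  rw [orthantFace, Pi.single_apply]
  congr 1
  simp only [Finset.mem_univ, true_implies, eq_iff_iff, funext_iff, Pi.zero_apply]
  exact ⟨fun h => h.2, fun h => ⟨fun i => (h i).ge, h⟩⟩

lemma orthantFace_mem (A : Finset (Fin d)) : orthantFace A ∈ coneSpan d := by
  induction A using Finset.induction_on with
  | empty =>
    rw [orthantFace_empty]
    exact genSeries_coneSet_mem _ linearIndependent_toR_single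
  | insert i A hi ih =>
    rw [eq_sub_of_add_eq (orthantFace_insert hi)]
    exact (coneSpan d).sub_mem ih (shiftSeries_mem _ ih)

lemma sigmaSet_parSet_single :
    sigmaSet d (parSet d 0 fun i => Pi.single i 1) = 1 := by
  have hset : {m : Fin d → ℤ | toR d m ∈ parSet d 0 fun i => Pi.single i 1} = {0} := by
    ext m
    simp only [parSet, Set.mem_ofPred_eq, eq_zero_add_sum_single_iff, Set.mem_singleton_iff]
    constructor
    · rintro ⟨lam, h0, h⟩
      ext i
      have h1 := h i ▸ h0 i
      have h2 : 0 ≤ m i := by exact_mod_cast h1.1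
      have h3 : m i < 1 := by exact_mod_cast h1.2
      simp only [Pi.zero_apply]
      omega
    · rintro rfl
      exact ⟨0, by simp, by simp⟩
  rw [sigmaSet, hset, finsum_mem_singleton, ratMon_zero]

namespace IsPhi

variable {φ : ((Fin d → ℤ) → ℂ) → RatF d} (hφ : IsPhi d φ)
include hφ

lemma map_orthantFace (A : Finset (Fin d)) :
    φ (orthantFace A) = (∏ i ∈ A, (1 - ratMon d (Pi.single i 1))) * φ (orthantFace ∅) := by
  induction A using Finset.induction_on with
  | empty => simp
  | insert i A hi ih =>
    have h := congrArg φ (orthantFace_insert hi)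
    rw [hφ.map_add (orthantFace_mem _) (shiftSeries_mem _ (orthantFace_mem _)),
      hφ.map_shiftSeries _ (orthantFace_mem _)] at h
    rw [Finset.prod_insert hi, mul_assoc, ← ih]
    linear_combination h

lemma map_single_zero : φ (Pi.single 0 1) = 1 := by
  rw [← orthantFace_univ, hφ.map_orthantFace, orthantFace_empty,
    hφ.2.2 _ _ linearIndependent_toR_single, sigmaSet_parSet_single]
  refine mul_one_div_cancel (Finset.prod_ne_zero_iff.2 fun i _ => ?_)
  rw [sub_ne_zero]
  exact (ratMon_ne_one (by simp)).symm

lemma map_genSeries_of_finite {S : Set (Fin d → ℝ)} (hS : {m | toR d m ∈ S}.Finite) :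
    φ (genSeries d S) = sigmaSet d S := by
  have hδ : (Pi.single 0 1 : (Fin d → ℤ) → ℂ) ∈ coneSpan d :=
    orthantFace_univ (d := d) ▸ orthantFace_mem _
  have hsum : genSeries d S = ∑ u ∈ hS.toFinset, shiftSeries u (Pi.single 0 1) := by
    ext m
    simp [genSeries, Finset.sum_apply, shiftSeries_apply, Pi.single_apply, sub_eq_zero]
  rw [hsum, hφ.map_sum _ fun u _ => shiftSeries_mem u hδ, sigmaSet,
    finsum_mem_eq_finite_toFinset_sum _ hS]
  refine Finset.sum_congr rfl fun u _ => ?_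
  rw [hφ.map_shiftSeries u hδ, hφ.map_single_zero, mul_one]

end IsPhi

lemma finite_setOf_toR_mem {S : Set (Fin d → ℝ)} (hS : Bornology.IsBounded S) :
    {m | toR d m ∈ S}.Finite := by
  obtain ⟨R, hR⟩ := hS.exists_norm_le
  refine (Set.finite_Icc (fun _ => -⌈R⌉) fun _ => ⌈R⌉).subset fun m hm => ?_
  have habs : ∀ i, |(m i : ℝ)| ≤ ⌈R⌉ := fun i =>
    ((norm_le_pi_norm (toR d m) i).trans (hR _ hm)).trans (Int.le_ceil R)
  exact ⟨fun i => by exact_mod_cast (abs_le.1 (habs i)).1,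
    fun i => by exact_mod_cast (abs_le.1 (habs i)).2⟩

lemma prod_signFactor_eq {w : Fin d → Fin d → ℤ}
    (hw : LinearIndependent ℝ (fun i => toR d (w i))) (v : Fin d → ℝ)
    {ξ : StrongDual ℝ (Fin d → ℝ)} (hξ : ∀ i, ξ (edgeBasis hw i) ≠ 0) {I : Finset (Fin d)}
    (hI : ∀ i, i ∈ I ↔ ξ (edgeBasis hw i) < 0) (m : Fin d → ℤ) :
    ((∏ i, signFactor (edgeBasis hw) ξ (toR d m - v) i : ℝ) : ℂ) =
      (-1) ^ I.card * genSeries d (halfOpenCone hw v I) m := by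
  have hpos : ∀ i, i ∉ I → 0 < ξ (edgeBasis hw i) := fun i hi =>
    (not_lt.1 fun h => hi ((hI i).2 h)).lt_of_ne (hξ i).symm
  rw [genSeries]
  split_ifs with hm
  · have : ∀ i, signFactor (edgeBasis hw) ξ (toR d m - v) i = if i ∈ I then -1 else 1 := by
      intro i
      have h := hm i
      split_ifs at h ⊢ with hi
      · rw [signFactor, nnSign, if_neg h.not_ge, Real.sign_of_neg ((hI i).1 hi)]; norm_num
      · rw [signFactor, nnSign, if_pos h, Real.sign_of_pos (hpos i hi)]; norm_num
    simp [this]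
  · simp only [halfOpenCone, Set.mem_ofPred_eq, not_forall] at hm
    obtain ⟨i, h⟩ := hm
    rw [Finset.prod_eq_zero (Finset.mem_univ i), Complex.ofReal_zero, mul_zero]
    split_ifs at h with hi
    · rw [signFactor, nnSign, if_pos (not_lt.1 h), Real.sign_of_neg ((hI i).1 hi)]; norm_num
    · rw [signFactor, nnSign, if_neg h, Real.sign_of_pos (hpos i hi)]; norm_num

lemma IsSimplePolytope.genSeries_eq {N : ℕ} [Nonempty (Fin N)] {v : Fin N → Fin d → ℝ}
    {w : Fin N → Fin d → Fin d → ℤ} (hw : ∀ k, LinearIndependent ℝ (fun i => toR d (w k i)))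
    (h : IsSimplePolytope v fun k => edgeBasis (hw k)) {ξ : StrongDual ℝ (Fin d → ℝ)}
    (hξ : ∀ k i, ξ (edgeBasis (hw k) i) ≠ 0) {I : Fin N → Finset (Fin d)}
    (hI : ∀ k i, i ∈ I k ↔ ξ (edgeBasis (hw k) i) < 0) :
    genSeries d (convexHull ℝ (Set.range v)) =
      ∑ k, (-1 : ℂ) ^ (I k).card • genSeries d (halfOpenCone (hw k) (v k) (I k)) := by
  ext m
  have hsum : (∑ k, (-1 : ℂ) ^ (I k).card • genSeries d (halfOpenCone (hw k) (v k) (I k))) m =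
      ((lvSum v (fun k => edgeBasis (hw k)) ξ (toR d m) : ℝ) : ℂ) := by
    rw [lvSum, Complex.ofReal_sum, Finset.sum_apply]
    exact Finset.sum_congr rfl fun k _ => (prod_signFactor_eq (hw k) (v k) (hξ k) (hI k) m).symm
  rw [hsum, genSeries]
  split_ifs with hm
  · rw [h.lvSum_eq_one hξ hm, Complex.ofReal_one]
  · rw [h.lvSum_eq_zero hξ hm, Complex.ofReal_zero]

end Series

/-- **Generalized Lawrence–Varchenko Formula.** As in the
Lawrence–Varchenko formula, but with a separate direction vector `ξ k` chosen at each
vertex `v k`, nonperpendicular to the edge directions at that vertex: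
`σ_P(x) = Σ_k (-1)^{|E⁻_{v k}(ξ k)|} φ(S_{K_{ξ k, v k}})` in `ℂ(x₁,…,x_d)`. -/
theorem statement10 (d N : ℕ) (v : Fin N → Fin d → ℝ) (hinj : Function.Injective v)
    (w : Fin N → Fin d → Fin d → ℤ) (xi : Fin N → Fin d → ℝ)
    (hrat : ∀ k i, ∃ q : ℚ, v k i = (q : ℝ))
    (hvert : Set.range v = Set.extremePoints ℝ (convexHull ℝ (Set.range v)))
    (hfull : (interior (convexHull ℝ (Set.range v))).Nonempty)
    (hsimple : ∀ k, LinearIndependent ℝ (fun i => toR d (w k i)))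
    (hcone : ∀ k, {y | ∃ t : ℝ, 0 < t ∧ v k + t • (y - v k) ∈ convexHull ℝ (Set.range v)}
        = coneSet d d (v k) (w k))
    (hxi : ∀ k i, dotR d (xi k) (toR d (w k i)) ≠ 0)
    (φ : ((Fin d → ℤ) → ℂ) → RatF d) (hφ : IsPhi d φ) :
    sigmaSet d (convexHull ℝ (Set.range v)) =
      ∑ k, (-1 : RatF d) ^
            (Finset.univ.filter (fun i => dotR d (xi k) (toR d (w k i)) < 0)).card *
          φ (genSeries d (lvCone d (v k) (w k) (xi k))) := by
  have hne : Nonempty (Fin N) := by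
    by_contra hN
    rw [not_nonempty_iff] at hN
    simp [Set.range_eq_empty] at hfull
  have hP : IsSimplePolytope v fun k => edgeBasis (hsimple k) :=
    ⟨hinj, hvert, fun k y => by rw [← mem_coneSet_iff, ← hcone k]; rfl⟩
  obtain ⟨ξ, hξ⟩ := (IsSimplePolytope.dense_setOf_forall_apply_ne_zero
    (u := fun p : Fin N × Fin d => edgeBasis (hsimple p.1) p.2)
    fun p => (edgeBasis (hsimple p.1)).ne_zero p.2).nonempty
  have hbdd : Bornology.IsBounded (convexHull ℝ (Set.range v)) :=
    ((Set.finite_range v).isCompact_convexHull (𝕜 := ℝ)).isBounded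
  rw [← hφ.map_genSeries_of_finite (finite_setOf_toR_mem hbdd),
    hP.genSeries_eq hsimple (fun k i => hξ (k, i))
      (I := fun k => {i | ξ (edgeBasis (hsimple k) i) < 0}) (by simp),
    hφ.map_sum _ fun k _ => (coneSpan d).smul_mem _ (genSeries_halfOpenCone_mem _ _ _)]
  refine Finset.sum_congr rfl fun k _ => ?_
  rw [hφ.map_neg_one_pow_smul _ (genSeries_halfOpenCone_mem _ _ _), hφ.map_halfOpenCone,
    lvCone_eq_halfOpenCone (hsimple k) (v k) (hxi k)
      (I := Finset.univ.filter fun i => dotR d (xi k) (toR d (w k i)) < 0) (by simp),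
    hφ.map_halfOpenCone]

end
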